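/- Let V be a variety that has a weak difference term. If an algebra A ∈ V has a tolerance T and a congruence δ such that C(T,T;δ) holds, then C(Cg(T),Cg(T);δ) holds, where Cg(T) is the congruence generated by T. -/

import Mathlib

open FirstOrder.Language FirstOrder.Language.Structure

universe u v w

/-- A binary relation on `A` is compatible with all (interpreted) operations of the
`L`-structure `A`. -/
def Compatible (L : FirstOrder.Language.{u, v}) (A : Type w) [L.Structure A]
    (T : A → A → Prop) : Prop :=
  ∀ (n : ℕ) (f : L.Functions n) (a b : Fin n → A),
    (∀ i, T (a i) (b i)) → T (funMap f a) (funMap f b)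

/-- A tolerance on `A`: a reflexive, symmetric, compatible binary relation. -/
def IsTolerance (L : FirstOrder.Language.{u, v}) (A : Type w) [L.Structure A]
    (T : A → A → Prop) : Prop :=
  Reflexive T ∧ Symmetric T ∧ Compatible L A T

/-- A congruence on `A`: a transitive tolerance. -/
def IsCongruence (L : FirstOrder.Language.{u, v}) (A : Type w) [L.Structure A]
    (T : A → A → Prop) : Prop :=
  IsTolerance L A T ∧ Transitive T

/-- The centralizer condition `C(S, T; δ)`: for every term `t(x, y₁, …, yₙ)`
(variable `0` playing the role of `x`), every `(a, b) ∈ S` and all pairs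
`(uᵢ, vᵢ) ∈ T`, if `(t(a, ū), t(a, v̄)) ∈ δ` then `(t(b, ū), t(b, v̄)) ∈ δ`. -/
def Centralizes (L : FirstOrder.Language.{u, v}) (A : Type w) [L.Structure A]
    (S T δ : A → A → Prop) : Prop :=
  ∀ (n : ℕ) (t : L.Term (Fin (n + 1))) (a b : A), S a b →
    ∀ u v : Fin n → A, (∀ i, T (u i) (v i)) →
      (δ (t.realize (Fin.cons a u)) (t.realize (Fin.cons a v)) →
        δ (t.realize (Fin.cons b u)) (t.realize (Fin.cons b v)))

/-- The algebra `A` satisfies every equation in the set `E` under every assignment: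
membership in the variety axiomatized by `E`. -/
def SatisfiesEqs (L : FirstOrder.Language.{u, v}) (A : Type w) [L.Structure A]
    (E : Set (Σ n : ℕ, L.Term (Fin n) × L.Term (Fin n))) : Prop :=
  ∀ e ∈ E, ∀ val : Fin e.1 → A, e.2.1.realize val = e.2.2.realize val

/-- `wt` is a weak difference term for the variety axiomatized by `E`: for every
algebra `A` in the variety, every abelian congruence `α` on `A`, and every
`(a, b) ∈ α`, `wt(a, a, b) = b` and `wt(b, a, a) = b`. -/
def IsWeakDifferenceTerm (L : FirstOrder.Language.{u, v})
    (E : Set (Σ n : ℕ, L.Term (Fin n) × L.Term (Fin n))) (wt : L.Term (Fin 3)) : Prop :=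
  ∀ (A : Type w) [L.Structure A], SatisfiesEqs L A E →
    ∀ α : A → A → Prop, IsCongruence L A α → Centralizes L A α α Eq →
      ∀ a b : A, α a b → wt.realize ![a, a, b] = b ∧ wt.realize ![b, a, a] = b

/-- The variety axiomatized by `E` has a Taylor term: an idempotent term
`t(x₁, …, xₙ)`, `n ≥ 1`, such that for each `i` the variety satisfies an identity
`t(w₁, …, wₙ) ≈ t(z₁, …, zₙ)` with `wᵢ ≠ zᵢ` (variables indexed by `ℕ`). -/
def HasTaylorTerm (L : FirstOrder.Language.{u, v})
    (E : Set (Σ n : ℕ, L.Term (Fin n) × L.Term (Fin n))) : Prop :=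
  ∃ (n : ℕ) (t : L.Term (Fin n)), 0 < n ∧
    (∀ (A : Type w) [L.Structure A], SatisfiesEqs L A E →
      ∀ a : A, t.realize (fun _ => a) = a) ∧
    (∀ i : Fin n, ∃ wv zv : Fin n → ℕ, wv i ≠ zv i ∧
      ∀ (A : Type w) [L.Structure A], SatisfiesEqs L A E →
        ∀ val : ℕ → A, t.realize (val ∘ wv) = t.realize (val ∘ zv))

open Function

section General

variable {L : FirstOrder.Language.{u, v}} {A : Type w} [L.Structure A]

/-- A reflexive transitive relation between values of `k` follows by changing the coordinates of
the argument one at a time. -/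
theorem rel_of_forall_update {ι α β : Type*} [Finite ι] [DecidableEq ι]
    {Q : β → β → Prop} (hrefl : ∀ x, Q x x) (htrans : ∀ x y z, Q x y → Q y z → Q x z)
    (k : (ι → α) → β) (a b : ι → α)
    (step : ∀ (i : ι) (e : ι → α), (∀ j, e j = a j ∨ e j = b j) →
      Q (k (update e i (a i))) (k (update e i (b i)))) : Q (k a) (k b) := by
  have := Fintype.ofFinite ι
  have key : ∀ s : Finset ι, Q (k a) (k (s.piecewise b a)) := by
    intro s
    induction s using Finset.induction_on with
    | empty => simpa using hrefl _
    | insert i s hi ih =>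
      refine htrans _ _ _ ih ?_
      have h := step i (s.piecewise b a) fun j => by
        by_cases hj : j ∈ s <;> simp [hj]
      rw [Finset.piecewise_insert]
      rwa [update_eq_self_iff.2 (by simp [hi])] at h
  simpa using key Finset.univ

theorem Compatible.realize {T : A → A → Prop} (hT : Compatible L A T) {ι : Type*}
    (t : L.Term ι) {p q : ι → A} (h : ∀ i, T (p i) (q i)) : T (t.realize p) (t.realize q) := by
  induction t with
  | var i => exact h i
  | func f ts ih => exact hT _ f _ _ ih

theorem compatible_of_update {R : A → A → Prop} (hrefl : ∀ x, R x x)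
    (htrans : ∀ x y z, R x y → R y z → R x z)
    (h : ∀ (n : ℕ) (f : L.Functions n) (e : Fin n → A) (i : Fin n) (x y : A), R x y →
      R (funMap f (update e i x)) (funMap f (update e i y))) : Compatible L A R :=
  fun n f a b hab => rel_of_forall_update hrefl htrans (fun e => funMap f e) a b
    fun i e _ => h n f e i _ _ (hab i)

namespace IsCongruence

variable {δ : A → A → Prop} (hδ : IsCongruence L A δ)
include hδ

theorem refl (a : A) : δ a a := hδ.1.1 a

theorem symm {a b : A} (h : δ a b) : δ b a := hδ.1.2.1 h

theorem trans {a b c : A} (h : δ a b) (h' : δ b c) : δ a c := hδ.2 h h'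

theorem realize {ι : Type*} (t : L.Term ι) {p q : ι → A} (h : ∀ i, δ (p i) (q i)) :
    δ (t.realize p) (t.realize q) := hδ.1.2.2.realize t h

/-- The setoid underlying a congruence. -/
@[reducible] def setoid : Setoid A := ⟨δ, hδ.refl, hδ.symm, hδ.trans⟩

/-- The quotient algebra by a congruence. -/
@[reducible] noncomputable def quotientStructure : L.Structure (Quotient hδ.setoid) where
  funMap f a := Quotient.mk _ (funMap f fun i => (a i).out)
  RelMap _ _ := True

theorem out_mk (a : A) : δ (Quotient.mk hδ.setoid a).out a :=
  Quotient.exact (s := hδ.setoid) (Quotient.out_eq _)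

theorem realize_mk {ι : Type*} (t : L.Term ι) (p : ι → A) :
    letI := hδ.quotientStructure
    t.realize (fun i => Quotient.mk hδ.setoid (p i)) = Quotient.mk hδ.setoid (t.realize p) := by
  let := hδ.quotientStructure
  induction t with
  | var i => rfl
  | func f ts ih =>
    refine Quotient.sound (s := hδ.setoid) (hδ.1.2.2 _ f _ _ fun i => ?_)
    change δ (Quotient.out ((ts i).realize _)) _
    rw [ih i]
    exact hδ.out_mk _

theorem realize_out {ι : Type*} (t : L.Term ι) (p : ι → Quotient hδ.setoid) :
    letI := hδ.quotientStructure
    t.realize p = Quotient.mk hδ.setoid (t.realize fun i => (p i).out) := by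
  rw [← hδ.realize_mk t]
  simp

end IsCongruence

theorem IsWeakDifferenceTerm.rel_of_centralizes
    {E : Set (Σ n : ℕ, L.Term (Fin n) × L.Term (Fin n))} {wt : L.Term (Fin 3)}
    (hw : IsWeakDifferenceTerm.{u, v, w} L E wt) (hA : SatisfiesEqs L A E)
    {δ κ : A → A → Prop} (hδ : IsCongruence L A δ) (hκ : IsCongruence L A κ)
    (hle : ∀ a b, δ a b → κ a b) (hC : Centralizes L A κ κ δ) {a b : A} (hab : κ a b) :
    δ (wt.realize ![a, a, b]) b ∧ δ (wt.realize ![b, a, a]) b := by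
  let := hδ.quotientStructure
  have hQ : SatisfiesEqs L (Quotient hδ.setoid) E := fun e he val => by
    rw [hδ.realize_out, hδ.realize_out, hA e he]
  have hout : ∀ a, κ (Quotient.mk hδ.setoid a).out a := fun a => hle _ _ (hδ.out_mk a)
  have hcong : IsCongruence L (Quotient hδ.setoid) fun p q => κ p.out q.out := by
    refine ⟨⟨fun p => hκ.refl _, fun p q h => hκ.symm h, fun n f p q h => ?_⟩,
      fun p q r h h' => hκ.trans h h'⟩
    exact hκ.trans (hout _) (hκ.trans (hκ.1.2.2 _ f _ _ h) (hκ.symm (hout _)))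
  have hcons : ∀ {n : ℕ} (p : Quotient hδ.setoid) (s : Fin n → Quotient hδ.setoid),
      (fun i => ((Fin.cons p s : Fin (n + 1) → Quotient hδ.setoid) i).out) =
        (Fin.cons p.out fun i => (s i).out : Fin (n + 1) → A) := fun p s => by
    funext i
    refine Fin.cases ?_ (fun j => ?_) i <;> simp
  have habel : Centralizes L (Quotient hδ.setoid) (fun p q => κ p.out q.out)
      (fun p q => κ p.out q.out) Eq := by
    intro n t p q hpq r s hrs h
    rw [hδ.realize_out, hδ.realize_out, hcons, hcons] at h ⊢
    exact Quotient.sound (s := hδ.setoid)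
      (hC n t _ _ hpq _ _ hrs (Quotient.exact (s := hδ.setoid) h))
  obtain ⟨h₁, h₂⟩ := hw _ hQ _ hcong habel (Quotient.mk _ a) (Quotient.mk _ b)
    (hκ.trans (hout a) (hκ.trans hab (hκ.symm (hout b))))
  have hvec : ∀ x y z : A, ![Quotient.mk hδ.setoid x, Quotient.mk _ y, Quotient.mk _ z] =
      fun i => Quotient.mk _ (![x, y, z] i) := fun x y z => by
    funext i
    fin_cases i <;> rfl
  rw [hvec, hδ.realize_mk] at h₁ h₂
  exact ⟨Quotient.exact (s := hδ.setoid) h₁, Quotient.exact (s := hδ.setoid) h₂⟩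

/-- If `Δ` meets both `β` and `γ` inside `δ`, then a weak difference term satisfies the Maltsev
equations modulo `δ` on the pairs of `Δ ∩ (β ∘ γ)`. -/
theorem IsWeakDifferenceTerm.rel_of_inf_le
    {E : Set (Σ n : ℕ, L.Term (Fin n) × L.Term (Fin n))} {wt : L.Term (Fin 3)}
    (hw : IsWeakDifferenceTerm.{u, v, w} L E wt) (hA : SatisfiesEqs L A E)
    {δ Δ β γ : A → A → Prop} (hδ : IsCongruence L A δ) (hΔ : IsCongruence L A Δ)
    (hβ : IsCongruence L A β) (hγ : IsCongruence L A γ)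
    (hδΔ : ∀ a b, δ a b → Δ a b) (hδβ : ∀ a b, δ a b → β a b) (hδγ : ∀ a b, δ a b → γ a b)
    (hΔβ : ∀ a b, Δ a b → β a b → δ a b) (hΔγ : ∀ a b, Δ a b → γ a b → δ a b)
    {p q r : A} (hpr : Δ p r) (hpq : β p q) (hqr : γ q r) :
    δ (wt.realize ![p, p, r]) r ∧ δ (wt.realize ![r, p, p]) r := by
  classical
  let J := Relation.TransGen fun a b => β a b ∨ γ a b
  have hJr : ∀ a, J a a := fun a => .single (.inl (hβ.refl a))
  have hJ : IsCongruence L A J := by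
    refine ⟨⟨hJr, fun a b h => ?_, compatible_of_update hJr (fun _ _ _ => .trans) ?_⟩,
      fun _ _ _ => .trans⟩
    · induction h with
      | single h => exact .single (h.imp hβ.symm hγ.symm)
      | tail _ h ih => exact .head (h.imp hβ.symm hγ.symm) ih
    · intro n f e i x y hxy
      refine Relation.TransGen.lift (fun x => funMap f (update e i x)) (fun x y h => ?_) _ _ hxy
      refine h.imp (fun h => hβ.1.2.2 _ f _ _ fun j => ?_) fun h => hγ.1.2.2 _ f _ _ fun j => ?_
      · by_cases hj : j = i
        · subst hj; simpa
        · simpa [hj] using hβ.refl _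
      · by_cases hj : j = i
        · subst hj; simpa
        · simpa [hj] using hγ.refl _
  have hcent : ∀ θ : A → A → Prop, IsCongruence L A θ → (∀ a b, δ a b → θ a b) →
      (∀ a b, Δ a b → θ a b → δ a b) → Centralizes L A θ Δ δ := by
    intro θ hθ hle hinf n t a b hab x y hxy h
    have hcol : ∀ s : Fin n → A,
        θ (t.realize (Fin.cons b s)) (t.realize (Fin.cons a s)) := fun s =>
      hθ.realize t (Fin.cases (by simpa using hθ.symm hab) fun i => by simpa using hθ.refl _)
    refine hinf _ _ (hΔ.realize t (Fin.cases (by simpa using hΔ.refl _) fun i => ?_))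
      (hθ.trans (hcol x) (hθ.trans (hle _ _ h) (hθ.symm (hcol y))))
    simpa using hxy i
  have hJC : Centralizes L A J Δ δ := by
    intro n t a b hab x y hxy
    induction hab with
    | single h =>
      exact h.elim (fun h => hcent β hβ hδβ hΔβ n t _ _ h x y hxy)
        fun h => hcent γ hγ hδγ hΔγ n t _ _ h x y hxy
    | tail _ h ih =>
      exact fun h₀ => h.elim (fun h => hcent β hβ hδβ hΔβ n t _ _ h x y hxy (ih h₀))
        fun h => hcent γ hγ hδγ hΔγ n t _ _ h x y hxy (ih h₀)
  refine hw.rel_of_centralizes hA (κ := fun a b => Δ a b ∧ J a b) hδ ?_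
    (fun a b h => ⟨hδΔ a b h, .single (.inl (hδβ a b h))⟩)
    (fun n t a b hab x y hxy => hJC n t a b hab.2 x y fun i => (hxy i).1)
    ⟨hpr, .trans (.single (.inl hpq)) (.single (.inr hqr))⟩
  exact ⟨⟨fun a => ⟨hΔ.refl a, hJ.refl a⟩, fun a b h => ⟨hΔ.symm h.1, hJ.symm h.2⟩,
    fun n f a b h => ⟨hΔ.1.2.2 n f a b fun i => (h i).1, hJ.1.2.2 n f a b fun i => (h i).2⟩⟩,
    fun a b c h h' => ⟨hΔ.trans h.1 h'.1, hJ.trans h.2 h'.2⟩⟩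

end General

section TermOperations

variable {L : FirstOrder.Language.{u, v}} {A : Type w} [L.Structure A]

variable (L A) in
/-- The ternary term operations of `A`. -/
def TernaryTermOp : Type w :=
  {f : (Fin 3 → A) → A // ∃ t : L.Term (Fin 3), ∀ x, t.realize x = f x}

namespace TernaryTermOp

/-- The algebra of ternary term operations of `A`, a subalgebra of a power of `A`. -/
instance : L.Structure (TernaryTermOp L A) where
  funMap f a := ⟨fun x => funMap f fun i => (a i).1 x,
    .func f fun i => (a i).2.choose, fun x => by
      simp only [FirstOrder.Language.Term.realize_func, fun i => (a i).2.choose_spec x]⟩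
  RelMap _ _ := True

theorem realize_val {ι : Type*} (t : L.Term ι) (p : ι → TernaryTermOp L A) (x : Fin 3 → A) :
    (t.realize p).1 x = t.realize fun i => (p i).1 x := by
  induction t with
  | var i => rfl
  | func f ts ih => exact congrArg (funMap f) (funext ih)

theorem satisfiesEqs {E : Set (Σ n : ℕ, L.Term (Fin n) × L.Term (Fin n))}
    (hA : SatisfiesEqs L A E) : SatisfiesEqs L (TernaryTermOp L A) E := fun e he val =>
  Subtype.ext <| funext fun x => by rw [realize_val, realize_val, hA e he]

/-- The projections. -/
def proj (i : Fin 3) : TernaryTermOp L A := ⟨fun x => x i, .var i, fun _ => rfl⟩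

theorem exists_realize_proj (f : TernaryTermOp L A) :
    ∃ t : L.Term (Fin 3), t.realize proj = f := by
  obtain ⟨f, t, ht⟩ := f
  exact ⟨t, Subtype.ext <| funext fun x => (realize_val t _ x).trans (ht x)⟩

/-- Idempotence of a ternary term operation. -/
def IsIdempotent (f : TernaryTermOp L A) : Prop := ∀ a, f.1 (fun _ => a) = a

theorem isIdempotent_proj (i : Fin 3) : (proj i : TernaryTermOp L A).IsIdempotent := fun _ => rfl

/-- The value at `f` of the unary polynomial obtained from the term `t` by plugging in the
projections for the variables other than `none`. -/
def eval (t : L.Term (Option (Fin 3))) (f : TernaryTermOp L A) : TernaryTermOp L A :=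
  t.realize fun o => o.elim f proj

theorem eval_val (t : L.Term (Option (Fin 3))) (f : TernaryTermOp L A) (x : Fin 3 → A) :
    (eval t f).1 x = t.realize fun o => o.elim (f.1 x) x := by
  rw [eval, realize_val]
  congr 1
  funext o
  cases o <;> rfl

theorem eval_const_congr (t : L.Term (Option (Fin 3))) {f g : TernaryTermOp L A}
    (h : ∀ a, f.1 (fun _ => a) = g.1 fun _ => a) (a : A) :
    (eval t f).1 (fun _ => a) = (eval t g).1 fun _ => a := by
  rw [eval_val, eval_val, h]

theorem isIdempotent_eval_iff (t : L.Term (Option (Fin 3))) {f : TernaryTermOp L A}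
    (hf : f.IsIdempotent) :
    (eval t f).IsIdempotent ↔ ∀ a : A, t.realize (fun _ => a) = a := by
  refine forall_congr' fun a => ?_
  rw [eval_val, hf]
  have : (fun o : Option (Fin 3) => o.elim a fun _ => a) = fun _ => a := by
    funext o
    cases o <;> rfl
  rw [this]

/-- An equivalence relation whose restriction to the idempotent ternary term operations is
preserved by the idempotent unary polynomials. -/
def IsInvariant (R : TernaryTermOp L A → TernaryTermOp L A → Prop) : Prop :=
  Equivalence R ∧ ∀ f g, f.IsIdempotent → g.IsIdempotent → R f g →
    ∀ t : L.Term (Option (Fin 3)), (∀ a : A, t.realize (fun _ => a) = a) →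
      R (eval t f) (eval t g)

theorem IsInvariant.inf {R S : TernaryTermOp L A → TernaryTermOp L A → Prop}
    (hR : IsInvariant R) (hS : IsInvariant S) : IsInvariant fun f g => R f g ∧ S f g :=
  ⟨⟨fun f => ⟨hR.1.refl f, hS.1.refl f⟩, fun h => ⟨hR.1.symm h.1, hS.1.symm h.2⟩,
    fun h h' => ⟨hR.1.trans h.1 h'.1, hS.1.trans h.2 h'.2⟩⟩,
    fun f g hf hg h t ht => ⟨hR.2 f g hf hg h.1 t ht, hS.2 f g hf hg h.2 t ht⟩⟩

/-- The largest congruence relating only operations with the same diagonal and restricting to a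
subset of `R` on the idempotent operations. -/
def syntacticCongruence (R : TernaryTermOp L A → TernaryTermOp L A → Prop)
    (p q : TernaryTermOp L A) : Prop :=
  (∀ a, p.1 (fun _ => a) = q.1 fun _ => a) ∧
    ∀ t : L.Term (Option (Fin 3)), (eval t p).IsIdempotent → R (eval t p) (eval t q)

theorem isCongruence_syntacticCongruence {R : TernaryTermOp L A → TernaryTermOp L A → Prop}
    (hR : Equivalence R) : IsCongruence L (TernaryTermOp L A) (syntacticCongruence R) := by
  have hrefl : ∀ p, syntacticCongruence R p p := fun p => ⟨fun _ => rfl, fun _ _ => hR.refl _⟩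
  have htrans : ∀ p q r, syntacticCongruence R p q → syntacticCongruence R q r →
      syntacticCongruence R p r := fun p q r h h' =>
    ⟨fun a => (h.1 a).trans (h'.1 a), fun t ht => hR.trans (h.2 t ht)
      (h'.2 t fun a => (eval_const_congr t h.1 a).symm.trans (ht a))⟩
  refine ⟨⟨hrefl, fun p q h => ⟨fun a => (h.1 a).symm, fun t ht => hR.symm
    (h.2 t fun a => (eval_const_congr t h.1 a).trans (ht a))⟩,
    compatible_of_update hrefl htrans fun n f e i x y hxy => ⟨fun a => ?_, fun t ht => ?_⟩⟩, htrans⟩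
  · refine congrArg (funMap f) (funext fun j => ?_)
    by_cases hj : j = i
    · subst hj; simpa using hxy.1 a
    · simp [hj]
  · choose s hs using fun j => exists_realize_proj (e j)
    have key : ∀ z, eval t (funMap f (update e i z)) = eval (t.subst fun o => o.elim
        (.func f fun j => if j = i then .var none else (s j).relabel some)
        fun j => .var (some j)) z := by
      intro z
      rw [eval, eval, FirstOrder.Language.Term.realize_subst]
      congr 1
      funext o
      cases o with
      | none =>
        refine congrArg (funMap f) (funext fun j => ?_)
        by_cases hj : j = i
        · subst hj; simp
        · simpa [hj, comp_def] using (hs j).symm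
      | some j => rfl
    rw [key] at ht ⊢
    rw [key]
    exact hxy.2 _ ht

theorem IsInvariant.syntacticCongruence_of_rel
    {R : TernaryTermOp L A → TernaryTermOp L A → Prop}
    (hR : IsInvariant R) {f g : TernaryTermOp L A} (hf : f.IsIdempotent) (hg : g.IsIdempotent)
    (h : R f g) : syntacticCongruence R f g :=
  ⟨fun a => (hf a).trans (hg a).symm,
    fun t ht => hR.2 f g hf hg h t ((isIdempotent_eval_iff t hf).1 ht)⟩

theorem rel_of_syntacticCongruence {R : TernaryTermOp L A → TernaryTermOp L A → Prop}
    {f g : TernaryTermOp L A} (hf : f.IsIdempotent) (h : syntacticCongruence R f g) : R f g :=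
  h.2 (.var none) hf

theorem syntacticCongruence_mono {R S : TernaryTermOp L A → TernaryTermOp L A → Prop}
    (hRS : ∀ f g, R f g → S f g) {p q : TernaryTermOp L A} (h : syntacticCongruence R p q) :
    syntacticCongruence S p q :=
  ⟨h.1, fun t ht => hRS _ _ (h.2 t ht)⟩

end TernaryTermOp

open TernaryTermOp in
/-- A weak difference term satisfies the Maltsev equations on the three projections modulo
`D ∩ B ∩ C`, as soon as `D ∩ B` and `D ∩ C` agree on the idempotent ternary operations. -/
theorem IsWeakDifferenceTerm.rel_proj
    {E : Set (Σ n : ℕ, L.Term (Fin n) × L.Term (Fin n))} {wt : L.Term (Fin 3)}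
    (hw : IsWeakDifferenceTerm.{u, v, w} L E wt) (hA : SatisfiesEqs L A E)
    (hidem : ∀ a : A, wt.realize (fun _ => a) = a)
    {D B C : TernaryTermOp L A → TernaryTermOp L A → Prop}
    (hD : IsInvariant D) (hB : IsInvariant B) (hC : IsInvariant C)
    (hDB : ∀ f g, f.IsIdempotent → g.IsIdempotent → D f g → B f g → C f g)
    (hDC : ∀ f g, f.IsIdempotent → g.IsIdempotent → D f g → C f g → B f g)
    (h₀₂ : D (proj 0) (proj 2)) (h₀₁ : B (proj 0) (proj 1)) (h₁₂ : C (proj 1) (proj 2)) :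
    (B (wt.realize ![proj 0, proj 0, proj 2]) (proj 2) ∧
      C (wt.realize ![proj 0, proj 0, proj 2]) (proj 2)) ∧
    (B (wt.realize ![proj 2, proj 0, proj 0]) (proj 2) ∧
      C (wt.realize ![proj 2, proj 0, proj 0]) (proj 2)) := by
  have hI := hD.inf (hB.inf hC)
  have hproj : ∀ i j k : Fin 3,
      (wt.realize ![proj i, proj j, proj k] : TernaryTermOp L A).IsIdempotent := fun i j k a => by
    rw [realize_val]
    refine Eq.trans (congrArg (fun x => wt.realize x) (funext fun l => ?_)) (hidem a)
    fin_cases l <;> rfl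
  have hside : ∀ {p q : TernaryTermOp L A}, syntacticCongruence D p q →
      ∀ t, (eval t p).IsIdempotent → (eval t q).IsIdempotent := fun h t ht a =>
    (eval_const_congr t h.1 a).symm.trans (ht a)
  obtain ⟨h, h'⟩ := hw.rel_of_inf_le (satisfiesEqs hA)
    (isCongruence_syntacticCongruence hI.1) (isCongruence_syntacticCongruence hD.1)
    (isCongruence_syntacticCongruence hB.1) (isCongruence_syntacticCongruence hC.1)
    (fun _ _ h => syntacticCongruence_mono (fun _ _ h => h.1) h)
    (fun _ _ h => syntacticCongruence_mono (fun _ _ h => h.2.1) h)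
    (fun _ _ h => syntacticCongruence_mono (fun _ _ h => h.2.2) h)
    (fun _ _ h h' => ⟨h.1, fun t ht => ⟨h.2 t ht, h'.2 t ht,
      hDB _ _ ht (hside h t ht) (h.2 t ht) (h'.2 t ht)⟩⟩)
    (fun _ _ h h' => ⟨h.1, fun t ht => ⟨h.2 t ht,
      hDC _ _ ht (hside h t ht) (h.2 t ht) (h'.2 t ht), h'.2 t ht⟩⟩)
    (hD.syntacticCongruence_of_rel (isIdempotent_proj 0) (isIdempotent_proj 2) h₀₂)
    (hB.syntacticCongruence_of_rel (isIdempotent_proj 0) (isIdempotent_proj 1) h₀₁)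
    (hC.syntacticCongruence_of_rel (isIdempotent_proj 1) (isIdempotent_proj 2) h₁₂)
  exact ⟨(rel_of_syntacticCongruence (hproj 0 0 2) h).2,
    (rel_of_syntacticCongruence (hproj 2 0 0) h').2⟩

end TermOperations

section Indistinguishable

variable {L : FirstOrder.Language.{u, v}} {A : Type w} [L.Structure A]

variable (L) in
/-- The pairs `p` and `q` are indistinguishable if every unary polynomial with coefficients in `T`,
acting on pairs, sends both or neither of them into `δ`. -/
def Indistinguishable (T δ : A → A → Prop) (p q : A × A) : Prop :=
  ∀ (n : ℕ) (t : L.Term (Fin (n + 1))) (x y : Fin n → A), (∀ i, T (x i) (y i)) →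
    (δ (t.realize (Fin.cons p.1 x)) (t.realize (Fin.cons p.2 y)) ↔
      δ (t.realize (Fin.cons q.1 x)) (t.realize (Fin.cons q.2 y)))

namespace Indistinguishable

variable {T δ : A → A → Prop}

theorem refl (p : A × A) : Indistinguishable L T δ p p := fun _ _ _ _ _ => Iff.rfl

theorem symm {p q : A × A} (h : Indistinguishable L T δ p q) : Indistinguishable L T δ q p :=
  fun n t x y hxy => (h n t x y hxy).symm

theorem trans {p q r : A × A} (h : Indistinguishable L T δ p q)
    (h' : Indistinguishable L T δ q r) : Indistinguishable L T δ p r :=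
  fun n t x y hxy => (h n t x y hxy).trans (h' n t x y hxy)

theorem of_centralizes (hT : IsTolerance L A T) (hC : Centralizes L A T T δ) {a b : A}
    (hab : T a b) : Indistinguishable L T δ (a, a) (b, b) := fun n t x y hxy =>
  ⟨hC n t a b hab x y hxy, hC n t b a (hT.2.1 hab) x y hxy⟩

theorem swap (hT : IsTolerance L A T) (hδ : IsCongruence L A δ) {p q : A × A}
    (h : Indistinguishable L T δ p q) : Indistinguishable L T δ p.swap q.swap :=
  fun n t x y hxy => by
    have := h n t y x fun i => hT.2.1 (hxy i)
    exact ⟨fun h => hδ.symm (this.1 (hδ.symm h)), fun h => hδ.symm (this.2 (hδ.symm h))⟩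

theorem of_rel_left (hδ : IsCongruence L A δ) {a b : A} (hab : δ a b) (c : A) :
    Indistinguishable L T δ (a, c) (b, c) := fun n t x y _ => by
  have h : δ (t.realize (Fin.cons a x)) (t.realize (Fin.cons b x)) :=
    hδ.realize t (Fin.cases (by simpa using hab) fun i => by simpa using hδ.refl _)
  exact ⟨hδ.trans (hδ.symm h), hδ.trans h⟩

theorem update_iff {p q : A × A} (h : Indistinguishable L T δ p q) {ι : Type*} [Finite ι]
    [DecidableEq ι] (t : L.Term ι) (i : ι) (x y : ι → A) (hxy : ∀ j ≠ i, T (x j) (y j))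
    (hT : IsTolerance L A T) :
    δ (t.realize (update x i p.1)) (t.realize (update y i p.2)) ↔
      δ (t.realize (update x i q.1)) (t.realize (update y i q.2)) := by
  obtain ⟨n, ⟨e⟩⟩ := Finite.exists_equiv_fin ι
  let s : L.Term (Fin (n + 1)) := t.relabel fun j => if j = i then 0 else (e j).succ
  have hs : ∀ (c : A) (x : ι → A),
      s.realize (Fin.cons c (update x i p.1 ∘ e.symm)) = t.realize (update x i c) := fun c x => by
    rw [FirstOrder.Language.Term.realize_relabel]
    congr 1
    funext j
    by_cases hj : j = i
    · subst hj; simp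
    · simp [hj]
  have key : ∀ c d : A, δ (s.realize (Fin.cons c (update x i p.1 ∘ e.symm)))
      (s.realize (Fin.cons d (update y i p.1 ∘ e.symm))) ↔
        δ (t.realize (update x i c)) (t.realize (update y i d)) := fun c d => by
    rw [hs, hs]
  rw [← key, ← key]
  refine h n s _ _ fun j => ?_
  by_cases hj : e.symm j = i
  · simpa [hj] using hT.1 _
  · simpa [hj] using hxy _ hj

theorem realize_iff (hT : IsTolerance L A T) {ι : Type*} [Finite ι] (t : L.Term ι)
    {p q : ι → A × A} (hp : ∀ i, T (p i).1 (p i).2) (hq : ∀ i, T (q i).1 (q i).2)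
    (h : ∀ i, Indistinguishable L T δ (p i) (q i)) :
    δ (t.realize fun i => (p i).1) (t.realize fun i => (p i).2) ↔
      δ (t.realize fun i => (q i).1) (t.realize fun i => (q i).2) := by
  classical
  refine rel_of_forall_update (Q := Iff) (fun _ => Iff.rfl) (fun _ _ _ => Iff.trans)
    (fun e : ι → A × A => δ (t.realize (Prod.fst ∘ e)) (t.realize (Prod.snd ∘ e))) p q
    fun i e he => ?_
  simp only [comp_update]
  refine (h i).update_iff t i _ _ (fun j _ => ?_) hT
  rcases he j with hj | hj
  · simpa [hj] using hp j
  · simpa [hj] using hq j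

theorem realize (hT : IsTolerance L A T) {ι : Type*} [Finite ι] (t : L.Term ι)
    {p q : ι → A × A} (hp : ∀ i, T (p i).1 (p i).2) (hq : ∀ i, T (q i).1 (q i).2)
    (h : ∀ i, Indistinguishable L T δ (p i) (q i)) :
    Indistinguishable L T δ (t.realize fun i => (p i).1, t.realize fun i => (p i).2)
      (t.realize fun i => (q i).1, t.realize fun i => (q i).2) := by
  intro n s x y hxy
  let s' : L.Term (ι ⊕ Fin n) :=
    s.subst (Fin.cases (t.relabel Sum.inl) fun i => .var (Sum.inr i))
  have hs : ∀ (f : A × A → A) (r : ι → A × A) (x : Fin n → A × A),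
      s.realize (Fin.cons (t.realize fun i => f (r i)) fun i => f (x i)) =
        s'.realize fun i => f (Sum.elim r x i) := fun f r x => by
    rw [FirstOrder.Language.Term.realize_subst]
    congr 1
    funext i
    refine Fin.cases ?_ (fun j => ?_) i
    · simp [comp_def]
    · simp
  have key : ∀ r : ι → A × A, _ := fun r => by
    have h₁ := hs Prod.fst r fun i => (x i, y i)
    have h₂ := hs Prod.snd r fun i => (x i, y i)
    exact And.intro h₁ h₂
  dsimp only at key ⊢
  rw [(key p).1, (key p).2, (key q).1, (key q).2]
  refine realize_iff hT s' ?_ ?_ ?_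
  · rintro (i | i)
    exacts [hp i, hxy i]
  · rintro (i | i)
    exacts [hq i, hxy i]
  · rintro (i | i)
    exacts [h i, .refl _]

end Indistinguishable

end Indistinguishable

section IdempotentTerms

variable {L : FirstOrder.Language.{u, v}} {A : Type w} [L.Structure A]

variable (L A) in
/-- A term in finitely many variables that is idempotent on `A`. -/
structure IdempotentTerm where
  /-- The index type of the variables. -/
  ι : Type
  /-- The underlying term. -/
  term : L.Term ι
  finite : Finite ι
  realize_const : ∀ a : A, term.realize (fun _ => a) = a

namespace IdempotentTerm

attribute [instance] IdempotentTerm.finite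

/-- The idempotent terms with one variable for each pair of a variable of `k` and one of `s`. -/
@[simps] def star (k s : IdempotentTerm L A) : IdempotentTerm L A where
  ι := k.ι × s.ι
  term := k.term.subst fun i => s.term.relabel (Prod.mk i)
  finite := inferInstance
  realize_const a := by
    simp [comp_def, realize_const]

theorem realize_star (k s : IdempotentTerm L A) (x : k.ι × s.ι → A) :
    (k.star s).term.realize x = k.term.realize fun i => s.term.realize fun j => x (i, j) := by
  simp [comp_def]

theorem realize_star_fst (k s : IdempotentTerm L A) (x : k.ι → A) :
    (k.star s).term.realize (x ∘ Prod.fst) = k.term.realize x := by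
  simp [comp_def, realize_const]

theorem realize_star_snd (k s : IdempotentTerm L A) (x : s.ι → A) :
    (k.star s).term.realize (x ∘ Prod.snd) = s.term.realize x := by
  simp [comp_def, realize_const]

/-- The idempotent term consisting of a single variable. -/
@[simps] def single : IdempotentTerm L A where
  ι := Unit
  term := .var ()
  finite := inferInstance
  realize_const _ := rfl

theorem exists_forall_minor (S : Finset (IdempotentTerm L A)) :
    ∃ k : IdempotentTerm L A, ∀ s ∈ S, ∃ π : k.ι → s.ι, ∀ x : s.ι → A,
      k.term.realize (x ∘ π) = s.term.realize x := by
  classical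
  induction S using Finset.induction_on with
  | empty => exact ⟨single, by simp⟩
  | insert s S _ ih =>
    obtain ⟨k, hk⟩ := ih
    refine ⟨k.star s, fun s' hs' => ?_⟩
    rcases Finset.mem_insert.1 hs' with rfl | hs'
    · exact ⟨Prod.snd, realize_star_snd k s'⟩
    · obtain ⟨π, hπ⟩ := hk s' hs'
      exact ⟨π ∘ Prod.fst, fun x => (realize_star_fst k s (x ∘ π)).trans (hπ x)⟩

/-- A coordinate `i` of `k` is stable if every identity between minors of `k` identifies the two
variables at `i`. -/
def IsStable (k : IdempotentTerm L A) (i : k.ι) : Prop :=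
  ∀ (ν : Type) (π ρ : k.ι → ν),
    (∀ x : ν → A, k.term.realize (x ∘ π) = k.term.realize (x ∘ ρ)) → π i = ρ i

/-- A choice of coordinates is compatible with all identities between minors. -/
def IsMinorCompatible (c : ∀ s : IdempotentTerm L A, s.ι) : Prop :=
  ∀ (s s' : IdempotentTerm L A) (ν : Type) (π : s.ι → ν) (ρ : s'.ι → ν),
    (∀ x : ν → A, s.term.realize (x ∘ π) = s'.term.realize (x ∘ ρ)) → π (c s) = ρ (c s')

/-- If every idempotent term has a stable coordinate, coordinates can be chosen compatibly with
all identities between minors. -/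
theorem exists_isMinorCompatible (h : ∀ k : IdempotentTerm L A, ∃ i, k.IsStable i) :
    ∃ c : ∀ s : IdempotentTerm L A, s.ι, IsMinorCompatible c := by
  classical
  choose i hi using h
  choose k π hπ using exists_forall_minor (L := L) (A := A)
  obtain ⟨c, hc⟩ := Finset.rado_selection (α := IdempotentTerm L A) (β := fun s => s.ι)
    fun S s => if hs : s ∈ S then π S s hs (i (k S)) else i s
  refine ⟨c, fun s s' ν σ ρ h => ?_⟩
  obtain ⟨S, hS, hcS⟩ := hc {s, s'}
  have hs : s ∈ S := hS (by simp)
  have hs' : s' ∈ S := hS (by simp)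
  rw [hcS s (by simp), hcS s' (by simp), dif_pos hs, dif_pos hs']
  refine hi (k S) ν (σ ∘ π S s hs) (ρ ∘ π S s' hs') fun x => ?_
  exact (hπ S s hs (x ∘ σ)).trans ((h x).trans (hπ S s' hs' (x ∘ ρ)).symm)

open Indistinguishable in
theorem exists_isStable {T δ : A → A → Prop} (hT : IsTolerance L A T) (hδ : IsCongruence L A δ)
    (hC : Centralizes L A T T δ) {x y z : A} (hxy : T x y) (hxz : T x z) (hyz : T y z)
    (h : Indistinguishable L T δ (x, y) (x, z)) (hne : ¬ δ y z) (k : IdempotentTerm L A) :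
    ∃ i, k.IsStable i := by
  classical
  obtain ⟨i, hi⟩ : ∃ i, ∀ e : k.ι → A, (∀ j, e j = x ∨ e j = y) →
      ¬ δ (k.term.realize (update e i y)) (k.term.realize (update e i z)) := by
    by_contra! hk
    refine hne ?_
    rw [← k.realize_const y, ← k.realize_const z]
    refine rel_of_forall_update hδ.refl (fun _ _ _ => hδ.trans) (fun e => k.term.realize e)
      (fun _ => y) (fun _ => z) fun i e he => ?_
    obtain ⟨e', he', h'⟩ := hk i
    have hupd : ∀ e : k.ι → A,
        (update e i y = fun j => (update (fun j => (e j, e j)) i (y, z) j).1) ∧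
          update e i z = fun j => (update (fun j => (e j, e j)) i (y, z) j).2 := fun e => by
      constructor <;> funext j <;> by_cases hj : j = i <;> simp [hj, update]
    have hTupd : ∀ (e : k.ι → A) (j), T (update (fun j => (e j, e j)) i (y, z) j).1
        (update (fun j => (e j, e j)) i (y, z) j).2 := fun e j => by
      by_cases hj : j = i
      · simpa [hj] using hyz
      · simpa [hj] using hT.1 _
    rw [(hupd e).1, (hupd e).2]
    rw [(hupd e').1, (hupd e').2] at h'
    refine (realize_iff hT k.term (hTupd e') (hTupd e) fun j => ?_).1 h'
    by_cases hj : j = i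
    · simpa [hj] using .refl _
    · simp only [update_of_ne hj]
      refine of_centralizes hT hC ?_
      rcases he j with h₁ | h₁ <;> rcases he' j with h₂ | h₂ <;> rw [h₁, h₂]
      exacts [hxy, hT.1 _, hxz, hyz]
  refine ⟨i, fun ν π ρ hk => ?_⟩
  by_contra hne'
  let e : ν → A := fun u => if u = π i then x else y
  have he : ∀ u, e u = x ∨ e u = y := fun u => by
    by_cases hu : u = π i <;> simp [e, hu]
  refine hi (e ∘ ρ) (fun j => he _) ?_
  have hupd := h.update_iff k.term i (e ∘ π) (e ∘ ρ) (fun j _ => ?_) hT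
  · have hπ : update (e ∘ π) i x = e ∘ π := by simp [e]
    have hρ : update (e ∘ ρ) i y = e ∘ ρ := by simp [e, Ne.symm hne']
    simp only [hπ, hρ, ← hk e] at hupd ⊢
    exact hupd.1 (hδ.refl _)
  · rcases he (π j) with h₁ | h₁ <;> rcases he (ρ j) with h₂ | h₂ <;>
      simp only [comp_apply, h₁, h₂]
    exacts [hT.1 _, hxy, hT.2.1 hxy, hT.1 _]

end IdempotentTerm

end IdempotentTerms

section Maltsev

variable {L : FirstOrder.Language.{u, v}} {A : Type w} [L.Structure A]

namespace TernaryTermOp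

/-- A term inducing an idempotent ternary term operation. -/
noncomputable def toIdempotentTerm (f : TernaryTermOp L A) (hf : f.IsIdempotent) :
    IdempotentTerm L A where
  ι := Fin 3
  term := f.2.choose
  finite := inferInstance
  realize_const a := (f.2.choose_spec _).trans (hf a)

theorem realize_toIdempotentTerm (f : TernaryTermOp L A) (hf : f.IsIdempotent) (x : Fin 3 → A) :
    (f.toIdempotentTerm hf).term.realize x = f.1 x := f.2.choose_spec x

open Classical in
/-- The coordinate chosen for an idempotent ternary term operation. -/
noncomputable def coord (c : ∀ s : IdempotentTerm L A, s.ι) (f : TernaryTermOp L A) : Fin 3 :=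
  if hf : f.IsIdempotent then c (f.toIdempotentTerm hf) else 0

section Coord

variable {c : ∀ s : IdempotentTerm L A, s.ι} (hc : IdempotentTerm.IsMinorCompatible c)
include hc

theorem coord_eq {f : TernaryTermOp L A} (hf : f.IsIdempotent) (t : IdempotentTerm L A)
    (π : t.ι → Fin 3) (h : ∀ x : Fin 3 → A, t.term.realize (x ∘ π) = f.1 x) :
    coord c f = π (c t) := by
  exact (dif_pos hf).trans (hc (f.toIdempotentTerm hf) t (Fin 3) id π fun x =>
    (f.realize_toIdempotentTerm hf x).trans (h x).symm)

theorem coord_proj (i : Fin 3) : coord c (proj i : TernaryTermOp L A) = i :=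
  coord_eq hc (isIdempotent_proj i) .single (fun _ => i) fun _ => rfl

theorem coord_eval (t : L.Term (Option (Fin 3))) (ht : ∀ a : A, t.realize (fun _ => a) = a)
    {f : TernaryTermOp L A} (hf : f.IsIdempotent) :
    coord c (eval t f) =
      (c ⟨Option (Fin 3), t, inferInstance, ht⟩ : Option (Fin 3)).elim (coord c f) id := by
  let k : IdempotentTerm L A := ⟨Option (Fin 3), t, inferInstance, ht⟩
  let s := f.toIdempotentTerm hf
  have h₁ : (c (k.star s)).1 = c k :=
    hc (k.star s) k (Option (Fin 3)) Prod.fst id (k.realize_star_fst s)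
  have h₂ : coord c f = (c (k.star s)).2 := coord_eq hc hf (k.star s) Prod.snd fun x =>
    (k.realize_star_snd s x).trans (f.realize_toIdempotentTerm hf x)
  have h₃ := coord_eq hc ((isIdempotent_eval_iff t hf).2 ht) (k.star s)
    (fun p => Option.elim p.1 p.2 id) fun x => by
      rw [eval_val]
      refine (k.realize_star s _).trans ?_
      refine congrArg (fun x => t.realize x) (funext fun o => ?_)
      cases o with
      | none => exact f.realize_toIdempotentTerm hf x
      | some l => exact s.realize_const (x l)
  rw [h₃, h₁, h₂]

theorem isInvariant_coord (P : Fin 3 → Prop) :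
    IsInvariant fun f g : TernaryTermOp L A => P (coord c f) ↔ P (coord c g) := by
  refine ⟨⟨fun _ => Iff.rfl, Iff.symm, Iff.trans⟩, fun f g hf hg h t ht => ?_⟩
  beta_reduce
  rw [coord_eval hc t ht hf, coord_eval hc t ht hg]
  cases (c ⟨Option (Fin 3), t, inferInstance, ht⟩ : Option (Fin 3)) with
  | none => exact h
  | some l => exact Iff.rfl

end Coord

theorem rel_of_isIdempotent {T : A → A → Prop} (hT : IsTolerance L A T)
    {f g : TernaryTermOp L A} (hf : f.IsIdempotent) (hg : g.IsIdempotent) {x y : Fin 3 → A}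
    (h : ∀ i j, T (x i) (y j)) : T (f.1 x) (g.1 y) := by
  have hop : ∀ (f : TernaryTermOp L A) {x y : Fin 3 → A}, (∀ i, T (x i) (y i)) →
      T (f.1 x) (f.1 y) := fun f x y h => by
    obtain ⟨t, ht⟩ := f.2
    rw [← ht, ← ht]
    exact hT.2.2.realize t h
  rw [← hf (g.1 y)]
  refine hop f fun i => ?_
  rw [← hg (x i)]
  exact hop g fun j => h i j

end TernaryTermOp

open TernaryTermOp

namespace IsWeakDifferenceTerm

variable {E : Set (Σ n : ℕ, L.Term (Fin n) × L.Term (Fin n))} {wt : L.Term (Fin 3)}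
  (hw : IsWeakDifferenceTerm.{u, v, w} L E wt) (hA : SatisfiesEqs L A E)
include hw hA

theorem realize_const (a : A) : wt.realize (fun _ => a) = a := by
  have h := (hw A hA Eq ⟨⟨fun _ => rfl, fun _ _ => Eq.symm, fun _ f _ _ h =>
    congrArg (funMap f) (funext h)⟩, fun _ _ _ => Eq.trans⟩ (fun n t a b hab x y hxy h => by
      rw [funext hxy]) a a rfl).1
  refine Eq.trans (congrArg (fun x => wt.realize x) (funext fun i => ?_)) h
  fin_cases i <;> rfl

theorem not_isMinorCompatible (c : ∀ s : IdempotentTerm L A, s.ι) :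
    ¬ IdempotentTerm.IsMinorCompatible c := by
  intro hc
  have hP := isInvariant_coord hc
  obtain ⟨⟨h, -⟩, h', -⟩ := hw.rel_proj hA (hw.realize_const hA) (hP (· = 1)) (hP (· = 2))
    (hP (· = 0)) (fun f g _ _ h h' => by grind) (fun f g _ _ h h' => by grind)
    (by simp [coord_proj hc]) (by simp [coord_proj hc]) (by simp [coord_proj hc])
  let k : IdempotentTerm L A := ⟨Fin 3, wt, inferInstance, hw.realize_const hA⟩
  have hk : ∀ l : Fin 3 → Fin 3,
      coord c (wt.realize ![proj (l 0), proj (l 1), proj (l 2)]) = l (c k) := fun l => by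
    have hval : ∀ x : Fin 3 → A,
        wt.realize (x ∘ l) = (wt.realize ![proj (l 0), proj (l 1), proj (l 2)]).1 x := fun x => by
      rw [realize_val]
      refine congrArg (fun x => wt.realize x) (funext fun i => ?_)
      fin_cases i <;> rfl
    exact coord_eq hc (fun a => (hval _).symm.trans (hw.realize_const hA a)) k l hval
  have hne : ∀ i : Fin 3, ![0, 0, 2] i = (2 : Fin 3) → ![2, 0, 0] i ≠ (2 : Fin 3) := by decide
  exact hne (c k) ((hk ![0, 0, 2]).symm.trans (h.2 (coord_proj hc 2)))
    ((hk ![2, 0, 0]).symm.trans (h'.2 (coord_proj hc 2)))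

variable {T δ : A → A → Prop} (hT : IsTolerance L A T) (hδ : IsCongruence L A δ)
  (hC : Centralizes L A T T δ)
include hT hδ hC

theorem rel_of_indistinguishable {x y z : A} (hxy : T x y) (hxz : T x z) (hyz : T y z)
    (h : Indistinguishable L T δ (x, y) (x, z)) : δ y z := by
  by_contra hne
  obtain ⟨c, hc⟩ := IdempotentTerm.exists_isMinorCompatible
    (IdempotentTerm.exists_isStable hT hδ hC hxy hxz hyz h hne)
  exact hw.not_isMinorCompatible hA c hc

open Indistinguishable in
theorem rel_of_rel {a b : A} (hab : T a b) :
    δ (wt.realize ![a, a, b]) b ∧ δ (wt.realize ![b, a, a]) b := by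
  have hall : ∀ p q : Fin 3 → A, (∀ i, p i = a ∨ p i = b) → (∀ i, q i = a ∨ q i = b) →
      ∀ i j, T (p i) (q j) := fun p q hp hq i j => by
    rcases hp i with h | h <;> rcases hq j with h' | h' <;> rw [h, h']
    exacts [hT.1 _, hab, hT.2.1 hab, hT.1 _]
  have h₁ : ∀ i, ![a, a, b] i = a ∨ ![a, a, b] i = b := fun i => by fin_cases i <;> simp
  have h₂ : ∀ i, ![a, b, b] i = a ∨ ![a, b, b] i = b := fun i => by fin_cases i <;> simp
  have hval : ∀ x : Fin 3 → A, IsInvariant fun f g : TernaryTermOp L A => δ (f.1 x) (g.1 x) :=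
    fun x => ⟨⟨fun _ => hδ.refl _, hδ.symm, hδ.trans⟩, fun f g _ _ h t _ => by
      beta_reduce
      rw [eval_val, eval_val]
      refine hδ.realize t fun o => ?_
      cases o with
      | none => exact h
      | some l => exact hδ.refl _⟩
  have hD : IsInvariant fun f g : TernaryTermOp L A => Indistinguishable L T δ
      (f.1 ![a, a, b], f.1 ![a, b, b]) (g.1 ![a, a, b], g.1 ![a, b, b]) := by
    refine ⟨⟨fun _ => .refl _, .symm, .trans⟩, fun f g hf hg h t _ => ?_⟩
    simp only [eval_val]
    have hTo : ∀ f : TernaryTermOp L A, f.IsIdempotent → ∀ o : Option (Fin 3),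
        T (o.elim (f.1 ![a, a, b]) ![a, a, b]) (o.elim (f.1 ![a, b, b]) ![a, b, b]) := by
      rintro f hf (_ | l)
      · exact rel_of_isIdempotent hT hf hf (hall _ _ h₁ h₂)
      · exact hall _ _ h₁ h₂ l l
    refine Indistinguishable.realize hT t
      (p := fun o => (o.elim (f.1 ![a, a, b]) ![a, a, b], o.elim (f.1 ![a, b, b]) ![a, b, b]))
      (q := fun o => (o.elim (g.1 ![a, a, b]) ![a, a, b], o.elim (g.1 ![a, b, b]) ![a, b, b]))
      (hTo f hf) (hTo g hg) fun o => ?_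
    cases o with
    | none => exact h
    | some l => exact .refl _
  obtain ⟨⟨h, -⟩, h', -⟩ := hw.rel_proj hA (hw.realize_const hA) hD (hval ![a, a, b])
    (hval ![a, b, b])
    (fun f g hf hg h h' => hw.rel_of_indistinguishable hA hT hδ hC
      (rel_of_isIdempotent hT hf hf (hall _ _ h₁ h₂))
      (rel_of_isIdempotent hT hf hg (hall _ _ h₁ h₂))
      (rel_of_isIdempotent hT hf hg (hall _ _ h₂ h₂))
      (h.trans (of_rel_left hδ (hδ.symm h') _)))
    (fun f g hf hg h h' => hw.rel_of_indistinguishable hA hT hδ hC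
      (rel_of_isIdempotent hT hf hf (hall _ _ h₂ h₁))
      (rel_of_isIdempotent hT hf hg (hall _ _ h₂ h₁))
      (rel_of_isIdempotent hT hf hg (hall _ _ h₁ h₁))
      ((h.swap hT hδ).trans (of_rel_left hδ (hδ.symm h') _)))
    (of_centralizes hT hC hab) (hδ.refl _) (hδ.refl _)
  have hvec : ∀ i j k : Fin 3, (wt.realize ![proj i, proj j, proj k]).1 ![a, a, b] =
      wt.realize ![![a, a, b] i, ![a, a, b] j, ![a, a, b] k] := fun i j k => by
    rw [realize_val]
    refine congrArg (fun x => wt.realize x) (funext fun l => ?_)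
    fin_cases l <;> rfl
  rw [hvec] at h h'
  exact ⟨h, h'⟩

theorem transGen_le {a b : A} (h : Relation.TransGen T a b) :
    ∃ a' b', δ a a' ∧ T a' b' ∧ δ b' b := by
  induction h with
  | single h => exact ⟨_, _, hδ.refl _, h, hδ.refl _⟩
  | @tail y z _ hyz ih =>
    obtain ⟨a', y', ha, hay, hy⟩ := ih
    refine ⟨wt.realize ![a', y', y], wt.realize ![y', y', z], hδ.trans ha (hδ.trans
      (hδ.symm (hw.rel_of_rel hA hT hδ hC (hT.2.1 hay)).2) (hδ.realize wt fun i => ?_)),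
      hT.2.2.realize wt fun i => ?_, hδ.trans (hδ.realize wt fun i => ?_)
      (hw.rel_of_rel hA hT hδ hC hyz).1⟩
    · fin_cases i
      exacts [hδ.refl _, hδ.refl _, hy]
    · fin_cases i
      exacts [hay, hT.1 _, hyz]
    · fin_cases i
      exacts [hy, hy, hδ.refl _]

end IsWeakDifferenceTerm

/-- Composing with `δ` on both sides does not affect the centralizer condition modulo `δ`. -/
theorem Centralizes.of_comp {S T S' T' δ : A → A → Prop} (hδ : IsCongruence L A δ)
    (hC : Centralizes L A S T δ)
    (hS : ∀ a b, S' a b → ∃ a' b', δ a a' ∧ S a' b' ∧ δ b' b)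
    (hT : ∀ a b, T' a b → ∃ a' b', δ a a' ∧ T a' b' ∧ δ b' b) :
    Centralizes L A S' T' δ := by
  intro n t a b hab x y hxy h
  obtain ⟨a', b', ha, hab', hb⟩ := hS a b hab
  choose x' y' hx hxy' hy using fun i => hT _ _ (hxy i)
  have key : ∀ {c d : A} {p q : Fin n → A}, δ c d → (∀ i, δ (p i) (q i)) →
      δ (t.realize (Fin.cons c p)) (t.realize (Fin.cons d q)) := fun hcd hpq =>
    hδ.realize t (Fin.cases (by simpa using hcd) fun i => by simpa using hpq i)
  have := hC n t a' b' hab' x' y' hxy' (hδ.trans (hδ.symm (key ha hx))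
    (hδ.trans h (key ha fun i => hδ.symm (hy i))))
  exact hδ.trans (hδ.symm (key hb fun i => hδ.symm (hx i))) (hδ.trans this (key hb hy))

end Maltsev

/-- Corrected Theorem 3.24 of "The Shape of Congruence Lattices": in a variety with
a weak difference term, if a tolerance `T` and a congruence `δ` on an algebra of
the variety satisfy `C(T, T; δ)`, then `C(Cg T, Cg T; δ)` holds, where `Cg T` is
the transitive closure of `T`. -/
theorem centralizes_transGen_of_weak_difference_term {L : FirstOrder.Language.{u, v}}
    (E : Set (Σ n : ℕ, L.Term (Fin n) × L.Term (Fin n)))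
    (hW : ∃ wt : L.Term (Fin 3), IsWeakDifferenceTerm.{u, v, w} L E wt)
    (A : Type w) [L.Structure A] (hA : SatisfiesEqs L A E)
    (T δ : A → A → Prop) (hT : IsTolerance L A T) (hδ : IsCongruence L A δ)
    (hC : Centralizes L A T T δ) :
    Centralizes L A (Relation.TransGen T) (Relation.TransGen T) δ := by
  obtain ⟨wt, hw⟩ := hW
  have hle := fun a b => hw.transGen_le hA hT hδ hC (a := a) (b := b)
  exact hC.of_comp hδ hle hle
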